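/- Let h₁, h₂, h₃ define bisectors and let p ∈ V satisfy ⟨p,p⟩ < 0, ⟨h₁p,p⟩ = 0, ⟨h₂p,p⟩ = 0, h₁p ≠ 0, and h₂p ≠ 0. Assume that no complex projective line containing [p] is contained in B_{h₁} ∩ B_{h₂}, and that no ℝ-plane containing [p] is contained in B_{h₁} ∩ B_{h₂}. If there is an open neighbourhood U ⊆ V of p such that every v ∈ U with ⟨h₁v,v⟩ = 0 and ⟨h₂v,v⟩ = 0 also satisfies ⟨h₃v,v⟩ = 0, then h₃ lies in the ℝ-linear span of h₁ and h₂. -/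

import Mathlib

open scoped ComplexConjugate

noncomputable section

/-- `V` is `ℂ³`. -/
abbrev V3 : Type := Fin 3 → ℂ

/-- The hermitian form of signature `(2,1)`:
`⟨x,y⟩ = x₀·conj y₀ + x₁·conj y₁ − x₂·conj y₂`. -/
def herm (x y : V3) : ℂ := x 0 * conj (y 0) + x 1 * conj (y 1) - x 2 * conj (y 2)

/-- The complex projective plane `ℙ(V)`. -/
abbrev PV : Type := Projectivization ℂ V3

/-- The class `[v]` of a nonzero vector `v` in `ℙ(V)`. -/
def projMk (v : V3) (hv : v ≠ 0) : PV := Projectivization.mk ℂ v hv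

/-- A map `h` is self-adjoint (`h* = h`) w.r.t. the hermitian form. -/
def SelfAdj (h : Module.End ℂ V3) : Prop := ∀ x y : V3, herm (h x) y = herm x (h y)

/-- The set `B_h = {[v] ∈ ℙ(V) | ⟨h v, v⟩ = 0}`. -/
def Bset (h : Module.End ℂ V3) : Set PV :=
  {q | ∃ v : V3, ∃ hv : v ≠ 0, q = projMk v hv ∧ herm (h v) v = 0}

/-- `h` defines a bisector: self-adjoint, trace `0`, rank `2`, and `B_h` contains
a point other than the focus (i.e. a point `[v]` with `h v ≠ 0`). -/
def IsBisector (h : Module.End ℂ V3) : Prop :=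
  SelfAdj h ∧ LinearMap.trace ℂ V3 h = 0 ∧
    Module.finrank ℂ (LinearMap.range h) = 2 ∧ ∃ v : V3, herm (h v) v = 0 ∧ h v ≠ 0

/-- A linear family of bisectors: an `ℝ`-subspace of self-adjoint traceless
degenerate maps whose base contains a negative point. -/
def IsLinearFamily (W : Submodule ℝ (Module.End ℂ V3)) : Prop :=
  (∀ h ∈ W, SelfAdj h ∧ LinearMap.trace ℂ V3 h = 0 ∧ LinearMap.det h = 0) ∧
    ∃ v : V3, ∃ hv : v ≠ 0, (herm v v).re < 0 ∧ ∀ h ∈ W, herm (h v) v = 0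

/-- The map `x ↦ ⟨x,p⟩·p`. -/
def wmap (p : V3) : Module.End ℂ V3 where
  toFun x := herm x p • p
  map_add' x y := by
    show herm (x + y) p • p = herm x p • p + herm y p • p
    have : herm (x + y) p = herm x p + herm y p := by
      simp only [herm, Pi.add_apply]; ring
    rw [this, add_smul]
  map_smul' c x := by
    show herm (c • x) p • p = c • (herm x p • p)
    have : herm (c • x) p = c * herm x p := by
      simp only [herm, Pi.smul_apply, smul_eq_mul]; ring
    rw [this, mul_smul]

/-- `ℙ(U)` for a complex subspace `U`. -/
def projC (U : Submodule ℂ V3) : Set PV :=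
  {q | ∃ v : V3, ∃ hv : v ≠ 0, v ∈ U ∧ q = projMk v hv}

/-- `ℙ(T)` for a real subspace `T`. -/
def projR (T : Submodule ℝ V3) : Set PV :=
  {q | ∃ v : V3, ∃ hv : v ≠ 0, v ∈ T ∧ q = projMk v hv}

/-- An `ℝ`-plane: `ℙ(T)` for a totally real `3`-dimensional real subspace `T`
with `ℂ·T = V`. -/
def IsRealPlane (T : Submodule ℝ V3) : Prop :=
  Module.finrank ℝ T = 3 ∧ Submodule.span ℂ (T : Set V3) = ⊤ ∧
    ∀ t ∈ T, ∀ t' ∈ T, (herm t t').im = 0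

/-- A geodesic: `ℙ(W₀)` for a `2`-dimensional real subspace `W₀` on which the form
is real-valued and not identically zero. -/
def IsGeodesic (W₀ : Submodule ℝ V3) : Prop :=
  Module.finrank ℝ W₀ = 2 ∧ (∀ w ∈ W₀, ∀ w' ∈ W₀, (herm w w').im = 0) ∧
    ∃ w ∈ W₀, ∃ w' ∈ W₀, herm w w' ≠ 0

/-- The real spine `R = {[h v] | [v] ∈ B_h, h v ≠ 0}` of `B_h`. -/
def RealSpine (h : Module.End ℂ V3) : Set PV :=
  {q | ∃ v : V3, ∃ hnz : h v ≠ 0, herm (h v) v = 0 ∧ q = projMk (h v) hnz}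

/-- The orthogonal complement w.r.t. the hermitian form. -/
def hermOrth (U : Submodule ℂ V3) : Submodule ℂ V3 where
  carrier := {x | ∀ u ∈ U, herm x u = 0}
  add_mem' := by
    intro a b ha hb u hu
    have h1 : herm (a + b) u = herm a u + herm b u := by
      simp only [herm, Pi.add_apply]; ring
    rw [h1, ha u hu, hb u hu, add_zero]
  zero_mem' := by
    intro u hu
    simp [herm]
  smul_mem' := by
    intro c x hx u hu
    have h1 : herm (c • x) u = c * herm x u := by
      simp only [herm, Pi.smul_apply, smul_eq_mul]; ring
    rw [h1, hx u hu, mul_zero]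


open scoped Topology
open Filter

lemma mem_closure_common_zeros {P₁ P₂ : ℝ × ℝ × ℝ → ℝ} (hP₁ : ContDiff ℝ 1 P₁)
    (hP₂ : ContDiff ℝ 1 P₂) (q₁ q₂ : ℝ) :
    ((0, -q₁ / 2, -q₂ / 2) : ℝ × ℝ × ℝ) ∈ closure {z : ℝ × ℝ × ℝ | z.1 ≠ 0 ∧
      q₁ + z.1 * P₁ z + 2 * z.2.1 = 0 ∧ q₂ + z.1 * P₂ z + 2 * z.2.2 = 0} := by
  set z₀ : ℝ × ℝ × ℝ := (0, -q₁ / 2, -q₂ / 2) with hz₀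
  have h1 : HasStrictFDerivAt (fun z : ℝ × ℝ × ℝ => z.1)
    (ContinuousLinearMap.fst ℝ ℝ (ℝ × ℝ)) z₀ := hasStrictFDerivAt_fst
  have h2 : HasStrictFDerivAt (fun z : ℝ × ℝ × ℝ => z.2.1)
    ((ContinuousLinearMap.fst ℝ ℝ ℝ).comp (ContinuousLinearMap.snd ℝ ℝ (ℝ × ℝ))) z₀ :=
    ((ContinuousLinearMap.fst ℝ ℝ ℝ).comp
      (ContinuousLinearMap.snd ℝ ℝ (ℝ × ℝ))).hasStrictFDerivAt
  have h3 : HasStrictFDerivAt (fun z : ℝ × ℝ × ℝ => z.2.2)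
    ((ContinuousLinearMap.snd ℝ ℝ ℝ).comp (ContinuousLinearMap.snd ℝ ℝ (ℝ × ℝ))) z₀ :=
    ((ContinuousLinearMap.snd ℝ ℝ ℝ).comp
      (ContinuousLinearMap.snd ℝ ℝ (ℝ × ℝ))).hasStrictFDerivAt
  have hE₁ := ((h1.mul (hP₁.contDiffAt.hasStrictFDerivAt (x := z₀) one_ne_zero)).const_add
    q₁).add (h2.const_mul 2)
  have hE₂ := ((h1.mul (hP₂.contDiffAt.hasStrictFDerivAt (x := z₀) one_ne_zero)).const_add
    q₂).add (h3.const_mul 2)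
  have hF := h1.prodMk (hE₁.prodMk hE₂)
  have hmap := hF.map_nhds_eq_of_surj (by
    rw [LinearMap.range_eq_top]
    rintro ⟨a, b, c⟩
    refine ⟨(a, (b - P₁ z₀ * a) / 2, (c - P₂ z₀ * a) / 2), ?_⟩
    simp [hz₀]
    constructor <;> ring)
  rw [mem_closure_iff_frequently]
  have key : ∃ᶠ y in 𝓝 ((0, 0, 0) : ℝ × ℝ × ℝ), y.1 ≠ 0 ∧ y.2.1 = 0 ∧ y.2.2 = 0 := by
    have hc : Tendsto (fun t : ℝ => ((t, 0, 0) : ℝ × ℝ × ℝ)) (𝓝[≠] 0) (𝓝 (0, 0, 0)) :=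
      ((by fun_prop : Continuous fun t : ℝ => ((t, 0, 0) : ℝ × ℝ × ℝ)).tendsto 0).mono_left
        nhdsWithin_le_nhds
    refine hc.frequently (Eventually.frequently ?_)
    filter_upwards [self_mem_nhdsWithin] with t ht
    exact ⟨ht, rfl, rfl⟩
  have h0 : ((0, 0, 0) : ℝ × ℝ × ℝ) = (z₀.1, q₁ + z₀.1 * P₁ z₀ + 2 * z₀.2.1,
      q₂ + z₀.1 * P₂ z₀ + 2 * z₀.2.2) := by
    simp [hz₀]
    constructor <;> ring
  rw [h0] at key
  erw [← hmap] at key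
  rw [Filter.frequently_map] at key
  exact key

lemma second_order_expansion {E : Type*} [AddCommGroup E] [Module ℝ E] [TopologicalSpace E]
    [ContinuousAdd E] [ContinuousSMul ℝ E]
    (B₁ B₂ B₃ : E →ₗ[ℝ] E →ₗ[ℝ] ℝ) (L₁ L₂ L₃ : E →ₗ[ℝ] ℝ) (u₁ u₂ : E)
    (h11 : L₁ u₁ = 1) (h12 : L₁ u₂ = 0) (h21 : L₂ u₁ = 0) (h22 : L₂ u₂ = 1)
    (hsub : ∀ᶠ v in 𝓝 (0 : E), B₁ v v + 2 * L₁ v = 0 → B₂ v v + 2 * L₂ v = 0 →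
      B₃ v v + 2 * L₃ v = 0) :
    ∃ α β : ℝ, L₃ = α • L₁ + β • L₂ ∧ ∃ g : E →ₗ[ℝ] E →ₗ[ℝ] ℝ,
      g = B₃ - α • B₁ - β • B₂ ∧ ∀ x, L₁ x = 0 → L₂ x = 0 → g x x = 0 ∧
        B₁ x x * (g x u₁ + g u₁ x) + B₂ x x * (g x u₂ + g u₂ x) = 0 := by
  set α := L₃ u₁ with hα
  set β := L₃ u₂ with hβ
  have key : ∀ x, L₁ x = 0 → L₂ x = 0 → L₃ x = 0 ∧
      (B₃ - α • B₁ - β • B₂) x x = 0 ∧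
        B₁ x x * ((B₃ - α • B₁ - β • B₂) x u₁ + (B₃ - α • B₁ - β • B₂) u₁ x) +
        B₂ x x * ((B₃ - α • B₁ - β • B₂) x u₂ + (B₃ - α • B₁ - β • B₂) u₂ x) = 0 := by
    intro x hx1 hx2
    set g := B₃ - α • B₁ - β • B₂ with hg
    have expand : ∀ (B : E →ₗ[ℝ] E →ₗ[ℝ] ℝ) (z : ℝ × ℝ × ℝ),
        B (z.1 • x + z.1 ^ 2 • (z.2.1 • u₁ + z.2.2 • u₂))
          (z.1 • x + z.1 ^ 2 • (z.2.1 • u₁ + z.2.2 • u₂)) =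
        z.1 ^ 2 * (B x x + z.1 * (z.2.1 * (B x u₁ + B u₁ x) + z.2.2 * (B x u₂ + B u₂ x) +
          z.1 * (z.2.1 ^ 2 * B u₁ u₁ + z.2.1 * z.2.2 * (B u₁ u₂ + B u₂ u₁) +
            z.2.2 ^ 2 * B u₂ u₂))) := by
      intro B z
      simp only [map_add, map_smul, LinearMap.add_apply, LinearMap.smul_apply, smul_eq_mul]
      ring
    have hcd : ∀ B : E →ₗ[ℝ] E →ₗ[ℝ] ℝ, ContDiff ℝ 1 fun z : ℝ × ℝ × ℝ =>
        z.2.1 * (B x u₁ + B u₁ x) + z.2.2 * (B x u₂ + B u₂ x) +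
          z.1 * (z.2.1 ^ 2 * B u₁ u₁ + z.2.1 * z.2.2 * (B u₁ u₂ + B u₂ u₁) +
            z.2.2 ^ 2 * B u₂ u₂) := by
      intro B
      fun_prop
    set z₀ : ℝ × ℝ × ℝ := (0, -(B₁ x x) / 2, -(B₂ x x) / 2) with hz₀
    have hfreq := mem_closure_common_zeros (hcd B₁) (hcd B₂) (B₁ x x) (B₂ x x)
    rw [mem_closure_iff_frequently, ← hz₀] at hfreq
    have hv : Tendsto (fun z : ℝ × ℝ × ℝ => z.1 • x + z.1 ^ 2 • (z.2.1 • u₁ + z.2.2 • u₂))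
        (𝓝 z₀) (𝓝 0) := by
      have hc : Continuous
          (fun z : ℝ × ℝ × ℝ => z.1 • x + z.1 ^ 2 • (z.2.1 • u₁ + z.2.2 • u₂)) := by fun_prop
      have := hc.tendsto z₀
      simpa [hz₀] using this
    have hzero : ∃ᶠ z in 𝓝 z₀, z.1 ≠ 0 ∧
        2 * L₃ x + z.1 * (g x x + z.1 * (z.2.1 * (g x u₁ + g u₁ x) +
          z.2.2 * (g x u₂ + g u₂ x) + z.1 * (z.2.1 ^ 2 * g u₁ u₁ +
            z.2.1 * z.2.2 * (g u₁ u₂ + g u₂ u₁) + z.2.2 ^ 2 * g u₂ u₂))) = 0 := by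
      refine (hfreq.and_eventually (hv.eventually hsub)).mono ?_
      rintro z ⟨⟨hz, he1, he2⟩, himp⟩
      refine ⟨hz, ?_⟩
      rw [expand, expand, expand] at himp
      simp only [map_add, map_smul, smul_eq_mul, hx1, hx2, h11, h12, h21, h22, ← hα, ← hβ]
        at himp
      have h3 := himp (by linear_combination z.1 ^ 2 * he1) (by linear_combination z.1 ^ 2 * he2)
      simp only [hg, LinearMap.sub_apply, LinearMap.smul_apply, smul_eq_mul]
      apply mul_left_cancel₀ hz
      linear_combination h3 - α * z.1 ^ 2 * he1 - β * z.1 ^ 2 * he2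
    have limit : ∀ f : ℝ × ℝ × ℝ → ℝ, Continuous f → (∃ᶠ z in 𝓝 z₀, z.1 ≠ 0 ∧ f z = 0) →
        f z₀ = 0 := by
      intro f hf hfr
      have : z₀ ∈ closure {z | f z = 0} :=
        mem_closure_iff_frequently.2 (hfr.mono fun z hz => hz.2)
      rwa [(isClosed_eq hf continuous_const).closure_eq] at this
    have hL : L₃ x = 0 := by
      have := limit _ (by fun_prop) hzero
      simpa [hz₀] using this
    have hzero' : ∃ᶠ z in 𝓝 z₀, z.1 ≠ 0 ∧
        g x x + z.1 * (z.2.1 * (g x u₁ + g u₁ x) +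
          z.2.2 * (g x u₂ + g u₂ x) + z.1 * (z.2.1 ^ 2 * g u₁ u₁ +
            z.2.1 * z.2.2 * (g u₁ u₂ + g u₂ u₁) + z.2.2 ^ 2 * g u₂ u₂)) = 0 :=
      hzero.mono fun z ⟨hz, h⟩ => ⟨hz, mul_left_cancel₀ hz (by linear_combination h - 2 * hL)⟩
    have hQ : g x x = 0 := by
      have := limit _ (by fun_prop) hzero'
      simpa [hz₀] using this
    have hzero'' : ∃ᶠ z in 𝓝 z₀, z.1 ≠ 0 ∧ z.2.1 * (g x u₁ + g u₁ x) +
          z.2.2 * (g x u₂ + g u₂ x) + z.1 * (z.2.1 ^ 2 * g u₁ u₁ +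
            z.2.1 * z.2.2 * (g u₁ u₂ + g u₂ u₁) + z.2.2 ^ 2 * g u₂ u₂) = 0 :=
      hzero'.mono fun z ⟨hz, h⟩ => ⟨hz, mul_left_cancel₀ hz (by linear_combination h - hQ)⟩
    have hC := limit _ (by fun_prop) hzero''
    simp only [hz₀] at hC
    exact ⟨hL, hQ, by linear_combination (-2) * hC⟩
  refine ⟨α, β, ?_, _, rfl, fun x hx1 hx2 => (key x hx1 hx2).2⟩
  ext v
  have := (key (v - L₁ v • u₁ - L₂ v • u₂) (by simp [h11, h12]) (by simp [h21, h22])).1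
  simp only [map_sub, map_smul, smul_eq_mul, ← hα, ← hβ] at this
  simp only [LinearMap.add_apply, LinearMap.smul_apply, smul_eq_mul]
  linear_combination this

/-- The real bilinear form polarizing the traceless hermitian form with entries `a`, `b`, `-a`. -/
def tracelessForm (a : ℝ) (b : ℂ) : (ℂ × ℂ) →ₗ[ℝ] (ℂ × ℂ) →ₗ[ℝ] ℝ :=
  LinearMap.mk₂ ℝ (fun x y => a * ((x.1 * conj y.1).re - (x.2 * conj y.2).re) +
      (b * (x.1 * conj y.2 + y.1 * conj x.2)).re)
    (by intros; simp; ring) (by intros; simp; ring) (by intros; simp; ring)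
    (by intros; simp; ring)

/-- The real linear form `w ↦ Re (c * conj w₁ + d * conj w₂)`. -/
def reLinear (c d : ℂ) : (ℂ × ℂ) →ₗ[ℝ] ℝ where
  toFun w := (c * conj w.1 + d * conj w.2).re
  map_add' := by intros; simp; ring
  map_smul' := by intros; simp; ring

/-- The quadratic polynomial `w ↦ ⟨h (p + w), p + w⟩` on the orthogonal complement of `p`. -/
def affineForm (a : ℝ) (b c d : ℂ) (w : ℂ × ℂ) : ℝ :=
  tracelessForm a b w w + 2 * reLinear c d w

lemma tracelessForm_apply (a : ℝ) (b : ℂ) (x y : ℂ × ℂ) :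
    tracelessForm a b x y = a * ((x.1 * conj y.1).re - (x.2 * conj y.2).re) +
      (b * (x.1 * conj y.2 + y.1 * conj x.2)).re := rfl

lemma reLinear_apply (c d : ℂ) (w : ℂ × ℂ) :
    reLinear c d w = (c * conj w.1 + d * conj w.2).re := rfl

lemma tracelessForm_comb (α β a₁ a₂ a₃ : ℝ) (b₁ b₂ b₃ : ℂ) :
    tracelessForm a₃ b₃ - α • tracelessForm a₁ b₁ - β • tracelessForm a₂ b₂ =
      tracelessForm (a₃ - α * a₁ - β * a₂) (b₃ - α * b₁ - β * b₂) := by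
  refine LinearMap.ext₂ fun x y => ?_
  simp [tracelessForm_apply]
  ring

lemma reLinear_eq_comb {α β : ℝ} {c₁ c₂ c₃ d₁ d₂ d₃ : ℂ}
    (h : reLinear c₃ d₃ = α • reLinear c₁ d₁ + β • reLinear c₂ d₂) :
    c₃ = α * c₁ + β * c₂ ∧ d₃ = α * d₁ + β * d₂ := by
  have h1 := LinearMap.congr_fun h (1, 0)
  have h2 := LinearMap.congr_fun h (Complex.I, 0)
  have h3 := LinearMap.congr_fun h (0, 1)
  have h4 := LinearMap.congr_fun h (0, Complex.I)
  simp [reLinear_apply] at h1 h2 h3 h4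
  constructor <;> apply Complex.ext <;> simp <;> assumption

lemma comb_of_linear_parts_independent (a₁ a₂ a₃ s d : ℝ) (b₁ b₂ b₃ c₃ d₃ : ℂ) (hd : d ≠ 0)
    (hsub : ∀ᶠ w in 𝓝 (0 : ℂ × ℂ), affineForm a₁ b₁ 1 0 w = 0 →
      affineForm a₂ b₂ (s * Complex.I) d w = 0 → affineForm a₃ b₃ c₃ d₃ w = 0)
    (hplane : ¬ (a₁ = 0 ∧ a₂ = 0 ∧ b₁.re = 0 ∧ b₂.re = 0 ∧ s = 0)) :
    ∃ α β : ℝ, a₃ = α * a₁ + β * a₂ ∧ b₃ = α * b₁ + β * b₂ ∧ c₃ = α + β * (s * Complex.I) ∧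
      d₃ = β * d := by
  obtain ⟨α, β, hL, g, hg, hx⟩ := second_order_expansion (tracelessForm a₁ b₁)
    (tracelessForm a₂ b₂) (tracelessForm a₃ b₃) (reLinear 1 0) (reLinear (s * Complex.I) d)
    (reLinear c₃ d₃) (1, 0) (0, ((1 / d : ℝ) : ℂ)) (by simp [reLinear_apply])
    (by simp [reLinear_apply]) (by simp [reLinear_apply])
    (by simp [reLinear_apply, hd]) hsub
  obtain ⟨hc, hdd⟩ := reLinear_eq_comb hL
  rw [tracelessForm_comb] at hg
  set a := a₃ - α * a₁ - β * a₂ with ha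
  set b := b₃ - α * b₁ - β * b₂ with hb
  have key : ∀ x y : ℝ, _ := fun x y => hx (⟨0, x⟩, ⟨-(s * x) / d, y⟩)
    (by simp [reLinear_apply]) (by simp [reLinear_apply]; field_simp; ring)
  subst hg
  simp [tracelessForm_apply] at key
  have ha0 : a = 0 := by
    have := (key 0 1).1
    simp at this
    linarith
  have hre : b.re = 0 := by
    have h1 := (key 1 1).1
    have h2 := (key 1 (-1)).1
    simp [ha0] at h1 h2
    linarith
  have him : b.im = 0 := by
    by_cases hs : s = 0
    · by_contra hne
      apply hplane
      have e : ∀ x y : ℝ, b.im * (y * (a₁ * (x * x - y * y) + 2 * b₁.re * (x * y)) -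
          x / d * (a₂ * (x * x - y * y) + 2 * b₂.re * (x * y))) = 0 := by
        intro x y
        have := (key x y).2
        simp [ha0, hre, hs] at this
        linear_combination this / 2
      replace e := fun x y : ℝ => (mul_eq_zero.1 (e x y)).resolve_left hne
      have e1 := e 1 0
      have e2 := e 0 1
      have e3 := e 1 1
      have e4 := e 1 (-1)
      simp [hd] at e1 e2
      simp [e1, e2] at e3 e4
      have e5 : d⁻¹ * b₂.re = 0 := by linarith
      refine ⟨e2, e1, by linarith, ?_, hs⟩
      simpa [hd] using e5
    · have h1 := (key 1 0).1
      simp [ha0, hre, hs, hd] at h1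
      exact h1
  refine ⟨α, β, by linarith, ?_, by simpa using hc, by simpa using hdd⟩
  have : b = 0 := Complex.ext hre him
  linear_combination this

lemma comb_of_linear_parts_complex_dependent (a₁ a₂ a₃ s : ℝ) (b₁ b₂ b₃ c₃ d₃ : ℂ) (hs : s ≠ 0)
    (hsub : ∀ᶠ w in 𝓝 (0 : ℂ × ℂ), affineForm a₁ b₁ 1 0 w = 0 →
      affineForm a₂ b₂ (s * Complex.I) 0 w = 0 → affineForm a₃ b₃ c₃ d₃ w = 0)
    (hslice : ¬ (a₁ = 0 ∧ a₂ = 0)) :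
    ∃ α β : ℝ, a₃ = α * a₁ + β * a₂ ∧ b₃ = α * b₁ + β * b₂ ∧ c₃ = α + β * (s * Complex.I) ∧
      d₃ = 0 := by
  obtain ⟨α, β, hL, g, hg, hx⟩ := second_order_expansion (tracelessForm a₁ b₁)
    (tracelessForm a₂ b₂) (tracelessForm a₃ b₃) (reLinear 1 0) (reLinear (s * Complex.I) 0)
    (reLinear c₃ d₃) (1, 0) (((1 / s : ℝ) : ℂ) * Complex.I, 0) (by simp [reLinear_apply])
    (by simp [reLinear_apply]) (by simp [reLinear_apply])
    (by simp [reLinear_apply, hs]) hsub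
  obtain ⟨hc, hdd⟩ := reLinear_eq_comb hL
  rw [tracelessForm_comb] at hg
  set a := a₃ - α * a₁ - β * a₂ with ha
  set b := b₃ - α * b₁ - β * b₂ with hb
  have key : ∀ x y : ℝ, _ := fun x y => hx (0, ⟨x, y⟩)
    (by simp [reLinear_apply]) (by simp [reLinear_apply])
  subst hg
  simp [tracelessForm_apply] at key
  have ha0 : a = 0 := by
    have := (key 0 1).1
    simp at this
    linarith
  have hb0 : b = 0 := by
    by_contra hne
    apply hslice
    have hN : 0 < b.re * b.re + b.im * b.im := by
      have := Complex.normSq_pos.2 hne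
      rwa [Complex.normSq_apply] at this
    have h1 := (key b.re b.im).2
    have h2 := (key (-b.im) b.re).2
    have e1 : (b.re * b.re + b.im * b.im) ^ 2 * a₁ = 0 := by linear_combination -h1 / 2
    have e2 : (b.re * b.re + b.im * b.im) ^ 2 * (s⁻¹ * a₂) = 0 := by
      linear_combination -h2 / 2
    simp [hN.ne', hs] at e1 e2
    exact ⟨e1, e2⟩
  refine ⟨α, β, by linarith, ?_, by simpa using hc, by simpa using hdd⟩
  linear_combination hb0

/-- Restricting to the complex lines through `(1, m)` that are isotropic for the second form. -/
lemma isotropic_line_relation (a₁ a₂ a₃ : ℝ) (b₁ b₂ b₃ c₃ d₃ : ℂ)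
    (hsub : ∀ᶠ w in 𝓝 (0 : ℂ × ℂ), affineForm a₁ b₁ 1 0 w = 0 →
      affineForm a₂ b₂ 0 0 w = 0 → affineForm a₃ b₃ c₃ d₃ w = 0)
    (m : ℂ) (hm : tracelessForm a₂ b₂ (1, m) (1, m) = 0) :
    (c₃ + d₃ * conj m).im = 0 ∧ tracelessForm a₃ b₃ (1, m) (1, m) =
      tracelessForm a₁ b₁ (1, m) (1, m) * (c₃ + d₃ * conj m).re := by
  set A := tracelessForm a₁ b₁ (1, m) (1, m) with hA
  set C := tracelessForm a₃ b₃ (1, m) (1, m) with hC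
  set e := c₃ + d₃ * conj m with he
  have quad : ∀ (a : ℝ) (b ζ : ℂ), tracelessForm a b (ζ, ζ * m) (ζ, ζ * m) =
      Complex.normSq ζ * tracelessForm a b (1, m) (1, m) := by
    intro a b ζ
    simp [tracelessForm_apply, Complex.normSq_apply]
    ring
  have hη : ∀ τ : ℝ, τ ≠ 0 → ((-(A / 2) : ℝ) + τ * Complex.I : ℂ) ≠ 0 := by
    intro τ hτ h
    have := congrArg Complex.im h
    simp at this
    exact hτ this
  have hlin : ∀ᶠ τ : ℝ in atTop, C - A * e.re - 2 * τ * e.im = 0 := by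
    have ht : Tendsto (fun τ : ℝ => ((-(A / 2) : ℝ) + τ * Complex.I : ℂ)⁻¹) atTop (𝓝 0) := by
      apply tendsto_inv₀_cobounded.comp
      rw [← tendsto_norm_atTop_iff_cobounded]
      refine tendsto_atTop_mono (fun τ => ?_) tendsto_id
      have := Complex.abs_im_le_norm ((-(A / 2) : ℝ) + τ * Complex.I : ℂ)
      simp at this
      exact (le_abs_self τ).trans (by simpa using this)
    have ht2 : Tendsto (fun τ : ℝ => (((-(A / 2) : ℝ) + τ * Complex.I : ℂ)⁻¹,
        ((-(A / 2) : ℝ) + τ * Complex.I : ℂ)⁻¹ * m)) atTop (𝓝 (0 : ℂ × ℂ)) := by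
      have := ht.prodMk_nhds (ht.mul_const m)
      rwa [zero_mul] at this
    filter_upwards [ht2.eventually hsub, eventually_gt_atTop 0] with τ hτ hpos
    set η : ℂ := (-(A / 2) : ℝ) + τ * Complex.I with hηd
    have hη0 : η ≠ 0 := hη τ hpos.ne'
    have hN : Complex.normSq η ≠ 0 := by simpa using hη0
    have hre : η.re = -(A / 2) := by simp [hηd]
    have him : η.im = τ := by simp [hηd]
    simp only [affineForm, quad, hm, ← hA, ← hC, Complex.normSq_inv] at hτ
    have h3 := hτ (by
      simp [reLinear_apply, Complex.inv_re, hre]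
      field_simp
      ring) (by simp [reLinear_apply])
    have h4 : reLinear c₃ d₃ (η⁻¹, η⁻¹ * m) = (e * η).re / Complex.normSq η := by
      have : c₃ * conj η⁻¹ + d₃ * conj (η⁻¹ * m) = e * η * ((1 / Complex.normSq η : ℝ) : ℂ) := by
        rw [Complex.inv_def]
        simp [he]
        ring
      rw [reLinear_apply]
      simp only [this, Complex.re_mul_ofReal]
      ring
    rw [h4, Complex.mul_re, hre, him] at h3
    field_simp at h3
    linear_combination h3
  obtain ⟨T, hT⟩ := eventually_atTop.1 hlin
  have h1 := hT T le_rfl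
  have h2 := hT (T + 1) (by linarith)
  have him : e.im = 0 := by linarith
  rw [him] at h1
  exact ⟨him, by linarith⟩

lemma comb_of_linear_part_zero (a₁ a₂ a₃ : ℝ) (b₁ b₂ b₃ c₃ d₃ : ℂ)
    (hsub : ∀ᶠ w in 𝓝 (0 : ℂ × ℂ), affineForm a₁ b₁ 1 0 w = 0 →
      affineForm a₂ b₂ 0 0 w = 0 → affineForm a₃ b₃ c₃ d₃ w = 0)
    (hslice : ¬ (a₁ = 0 ∧ a₂ = 0)) :
    ∃ α β : ℝ, a₃ = α * a₁ + β * a₂ ∧ b₃ = α * b₁ + β * b₂ ∧ c₃ = α ∧ d₃ = 0 := by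
  have rel : ∀ x y : ℝ, _ := fun x y =>
    isotropic_line_relation a₁ a₂ a₃ b₁ b₂ b₃ c₃ d₃ hsub ⟨x, y⟩
  simp [tracelessForm_apply] at rel
  by_cases ha₂ : a₂ = 0
  · have ha₁ : a₁ ≠ 0 := fun h => hslice ⟨h, ha₂⟩
    by_cases hb₂ : b₂ = 0
    · simp [ha₂, hb₂] at rel
      obtain ⟨i1, r1⟩ := rel 0 0
      obtain ⟨i2, r2⟩ := rel 1 0
      obtain ⟨i3, r3⟩ := rel 0 1
      obtain ⟨i4, r4⟩ := rel (-1) 0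
      obtain ⟨i5, r5⟩ := rel 0 (-1)
      simp at i1 r1 i2 r2 i3 r3 i4 r4 i5 r5
      have hdi : d₃.im = 0 := by linarith
      have hdr : d₃.re = 0 := by linarith
      simp [hdi, hdr] at r1 r2 r3 r4 r5
      refine ⟨c₃.re, 0, by linarith, ?_, ?_, Complex.ext hdr hdi⟩
      · apply Complex.ext <;> simp <;> linarith
      · apply Complex.ext <;> simp [i1]
    · have hN : 0 < b₂.re * b₂.re + b₂.im * b₂.im := by
        have := Complex.normSq_pos.2 hb₂
        rwa [Complex.normSq_apply] at this
      set N := b₂.re * b₂.re + b₂.im * b₂.im with hNd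
      have line : ∀ τ : ℝ, _ := fun τ => rel (-τ * b₂.im) (τ * b₂.re) (by rw [ha₂]; ring)
      obtain ⟨i0, r0⟩ := line 0
      obtain ⟨i1, r1⟩ := line 1
      obtain ⟨i2, r2⟩ := line (-1)
      obtain ⟨i3, r3⟩ := line 2
      have hd1 : d₃.re * b₂.re + d₃.im * b₂.im = 0 := by linear_combination (i2 - i1) / 2
      have hk : a₁ * N * (d₃.im * b₂.re - d₃.re * b₂.im) = 0 := by
        rw [hNd]
        linear_combination (r3 - 3 * r1 + 3 * r0 - r2) / 6
      have hd2 : d₃.im * b₂.re - d₃.re * b₂.im = 0 := by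
        simpa [ha₁, hN.ne'] using hk
      have hdr : d₃.re = 0 := by
        have : N * d₃.re = 0 := by rw [hNd]; linear_combination b₂.re * hd1 - b₂.im * hd2
        simpa [hN.ne'] using this
      have hdi : d₃.im = 0 := by
        have : N * d₃.im = 0 := by rw [hNd]; linear_combination b₂.im * hd1 + b₂.re * hd2
        simpa [hN.ne'] using this
      simp only [hdr, hdi] at i0 r0 r1 r2
      have hci : c₃.im = 0 := by linear_combination i0
      have hp : b₂.re * (b₃.im - c₃.re * b₁.im) - b₂.im * (b₃.re - c₃.re * b₁.re) = 0 := by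
        linear_combination (r1 - r2) / 4
      refine ⟨c₃.re, (b₂.re * (b₃.re - c₃.re * b₁.re) + b₂.im * (b₃.im - c₃.re * b₁.im)) / N,
        ?_, ?_, Complex.ext rfl hci, Complex.ext hdr hdi⟩
      · rw [ha₂]
        linear_combination r0
      · apply Complex.ext
        · simp
          field_simp
          rw [hNd]
          linear_combination (-b₂.im) * hp
        · simp
          field_simp
          rw [hNd]
          linear_combination b₂.re * hp
  · set ρ := Real.sqrt (1 + (b₂.re / a₂) ^ 2 + (b₂.im / a₂) ^ 2) with hρd
    have hpos : 0 < 1 + (b₂.re / a₂) ^ 2 + (b₂.im / a₂) ^ 2 := by positivity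
    have hρ : ρ ^ 2 = 1 + (b₂.re / a₂) ^ 2 + (b₂.im / a₂) ^ 2 := Real.sq_sqrt hpos.le
    have hρ0 : ρ ≠ 0 := (Real.sqrt_pos.2 hpos).ne'
    set u := b₂.re / a₂ with hu
    set v := b₂.im / a₂ with hv
    have hbr : b₂.re = a₂ * u := by rw [hu]; field_simp
    have hbi : b₂.im = a₂ * v := by rw [hv]; field_simp
    rw [hbr, hbi] at rel
    obtain ⟨i1, r1⟩ := rel (u + ρ) v (by linear_combination -a₂ * hρ)
    obtain ⟨i2, r2⟩ := rel (u - ρ) v (by linear_combination -a₂ * hρ)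
    obtain ⟨i3, r3⟩ := rel u (v + ρ) (by linear_combination -a₂ * hρ)
    obtain ⟨i4, r4⟩ := rel u (v - ρ) (by linear_combination -a₂ * hρ)
    have hdi : d₃.im = 0 := mul_left_cancel₀ hρ0 (by linear_combination (i1 - i2) / 2)
    have hdr : d₃.re = 0 := mul_left_cancel₀ hρ0 (by linear_combination (i4 - i3) / 2)
    simp only [hdi, hdr] at i1 r1 r2 r3 r4
    have hci : c₃.im = 0 := by linear_combination i1
    set β := (a₃ - c₃.re * a₁) / a₂ with hβ
    have ha₃ : a₃ = c₃.re * a₁ + β * a₂ := by rw [hβ]; field_simp; ring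
    refine ⟨c₃.re, β, ha₃, ?_, Complex.ext rfl hci, Complex.ext hdr hdi⟩
    rw [ha₃] at r1 r2 r3 r4
    apply Complex.ext
    · simp [hbr]
      apply mul_left_cancel₀ hρ0
      linear_combination (r1 - r2) / 4
    · simp [hbi]
      apply mul_left_cancel₀ hρ0
      linear_combination (r3 - r4) / 4

lemma affineForm_comb (α β a₁ a₂ : ℝ) (b₁ b₂ c₁ c₂ d₁ d₂ : ℂ) (w : ℂ × ℂ) :
    affineForm (α * a₁ + β * a₂) (α * b₁ + β * b₂) (α * c₁ + β * c₂) (α * d₁ + β * d₂) w =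
      α * affineForm a₁ b₁ c₁ d₁ w + β * affineForm a₂ b₂ c₂ d₂ w := by
  simp [affineForm, tracelessForm_apply, reLinear_apply]
  ring

theorem affineForm_coeff_comb (a₁ a₂ a₃ d₂ : ℝ) (b₁ b₂ b₃ c₂ c₃ d₃ : ℂ)
    (hsub : ∀ᶠ w in 𝓝 (0 : ℂ × ℂ), affineForm a₁ b₁ 1 0 w = 0 →
      affineForm a₂ b₂ c₂ d₂ w = 0 → affineForm a₃ b₃ c₃ d₃ w = 0)
    (hslice : ¬ (a₁ = 0 ∧ a₂ = 0 ∧ d₂ = 0))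
    (hplane : ¬ (a₁ = 0 ∧ a₂ = 0 ∧ b₁.re = 0 ∧ b₂.re = 0 ∧ c₂.im = 0)) :
    ∃ α β : ℝ, a₃ = α * a₁ + β * a₂ ∧ b₃ = α * b₁ + β * b₂ ∧ c₃ = α + β * c₂ ∧
      d₃ = β * d₂ := by
  have hc : c₂ - c₂.re = c₂.im * Complex.I := by apply Complex.ext <;> simp
  suffices h : ∃ α β : ℝ, a₃ = α * a₁ + β * (a₂ - c₂.re * a₁) ∧
      b₃ = α * b₁ + β * (b₂ - c₂.re * b₁) ∧ c₃ = α + β * (c₂.im * Complex.I) ∧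
      d₃ = β * d₂ by
    obtain ⟨α, β, h1, h2, h3, h4⟩ := h
    refine ⟨α - β * c₂.re, β, by linear_combination h1, ?_, ?_, h4⟩
    · push_cast
      linear_combination h2
    · push_cast
      linear_combination h3 - β * hc
  have hsub' : ∀ᶠ w in 𝓝 (0 : ℂ × ℂ), affineForm a₁ b₁ 1 0 w = 0 →
      affineForm (a₂ - c₂.re * a₁) (b₂ - c₂.re * b₁) (c₂.im * Complex.I) d₂ w = 0 →
      affineForm a₃ b₃ c₃ d₃ w = 0 := by
    filter_upwards [hsub] with w hw h1 h2
    refine hw h1 ?_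
    have := affineForm_comb c₂.re 1 a₁ (a₂ - c₂.re * a₁) b₁ (b₂ - c₂.re * b₁) 1
      (c₂.im * Complex.I) 0 d₂ w
    rw [h1, h2, ← hc] at this
    simpa using this
  by_cases hd : d₂ = 0
  · have hslice' : ¬ (a₁ = 0 ∧ a₂ - c₂.re * a₁ = 0) := by
      rintro ⟨h1, h2⟩
      exact hslice ⟨h1, by simpa [h1] using h2, hd⟩
    subst hd
    by_cases hs : c₂.im = 0
    · rw [hs] at hsub' ⊢
      obtain ⟨α, β, h1, h2, h3, h4⟩ := comb_of_linear_part_zero a₁ _ a₃ b₁ _ b₃ c₃ d₃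
        (by simpa using hsub') hslice'
      exact ⟨α, β, h1, by simpa using h2, by simpa using h3, by simpa using h4⟩
    · obtain ⟨α, β, h1, h2, h3, h4⟩ := comb_of_linear_parts_complex_dependent a₁ _ a₃ _ b₁ _ b₃
        c₃ d₃ hs (by simpa using hsub') hslice'
      exact ⟨α, β, h1, h2, h3, by simpa using h4⟩
  · refine comb_of_linear_parts_independent a₁ _ a₃ _ d₂ b₁ _ b₃ c₃ d₃ hd hsub' ?_
    rintro ⟨h1, h2, h3, h4, h5⟩
    refine hplane ⟨h1, by simpa [h1] using h2, h3, ?_, h5⟩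
    simpa [h3] using h4

lemma herm_add_left (x y z : V3) : herm (x + y) z = herm x z + herm y z := by
  simp only [herm, Pi.add_apply]; ring

lemma herm_smul_left (c : ℂ) (x y : V3) : herm (c • x) y = c * herm x y := by
  simp only [herm, Pi.smul_apply, smul_eq_mul]; ring

lemma herm_conj_symm (x y : V3) : conj (herm x y) = herm y x := by
  simp only [herm, map_add, map_sub, map_mul, Complex.conj_conj]; ring

lemma herm_add_right (x y z : V3) : herm x (y + z) = herm x y + herm x z := by
  simp only [herm, Pi.add_apply, map_add]; ring

lemma herm_smul_right (c : ℂ) (x y : V3) : herm x (c • y) = conj c * herm x y := by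
  simp only [herm, Pi.smul_apply, smul_eq_mul, map_mul]; ring

lemma herm_self_im (x : V3) : (herm x x).im = 0 := by
  simp [herm]; ring

lemma herm_self_eq_re (x : V3) : herm x x = (herm x x).re :=
  Complex.ext rfl (by simp [herm_self_im])

lemma SelfAdj.herm_self_im {h : Module.End ℂ V3} (hs : SelfAdj h) (v : V3) :
    (herm (h v) v).im = 0 := by
  have := congrArg Complex.im (herm_conj_symm (h v) v)
  rw [← hs] at this
  simp at this
  linarith

/-- A positive multiple of an orthonormal frame of the orthogonal complement of `p`. -/
structure AdaptedFrame (p e₁ e₂ : V3) (ρ : ℝ) : Prop where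
  neg : (herm p p).re < 0
  pos : 0 < ρ
  e₁_e₁ : herm e₁ e₁ = ρ
  e₂_e₂ : herm e₂ e₂ = ρ
  e₁_e₂ : herm e₁ e₂ = 0
  e₁_p : herm e₁ p = 0
  e₂_p : herm e₂ p = 0

lemma herm_pos_of_orthogonal_neg {p q : V3} (hp : (herm p p).re < 0) (hqp : herm q p = 0)
    (hq : q ≠ 0) : 0 < (herm q q).re := by
  have hp' : Complex.normSq (p 0) + Complex.normSq (p 1) < Complex.normSq (p 2) := by
    simp [herm] at hp
    simp only [Complex.normSq_apply]
    linarith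
  have hq' : (herm q q).re =
      Complex.normSq (q 0) + Complex.normSq (q 1) - Complex.normSq (q 2) := by
    simp [herm, Complex.normSq_apply]
  have horth : q 0 * conj (p 0) + q 1 * conj (p 1) = q 2 * conj (p 2) :=
    sub_eq_zero.1 hqp
  have lag : Complex.normSq (q 0 * conj (p 0) + q 1 * conj (p 1)) +
      Complex.normSq (q 0 * p 1 - q 1 * p 0) =
      (Complex.normSq (q 0) + Complex.normSq (q 1)) *
        (Complex.normSq (p 0) + Complex.normSq (p 1)) := by
    simp [Complex.normSq_apply]
    ring
  rw [horth, Complex.normSq_mul, Complex.normSq_conj] at lag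
  have h0 := Complex.normSq_nonneg (q 0 * p 1 - q 1 * p 0)
  have hq0 := Complex.normSq_nonneg (q 0)
  have hq1 := Complex.normSq_nonneg (q 1)
  have hp0 := Complex.normSq_nonneg (p 0)
  have hp1 := Complex.normSq_nonneg (p 1)
  rw [hq']
  by_contra hle
  push Not at hle
  have hp2 : 0 < Complex.normSq (p 2) := by linarith
  have h1 : (Complex.normSq (q 0) + Complex.normSq (q 1)) *
      (Complex.normSq (p 2) - Complex.normSq (p 0) - Complex.normSq (p 1)) ≤ 0 := by
    nlinarith
  have h2 : Complex.normSq (q 0) + Complex.normSq (q 1) = 0 := by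
    by_contra hne
    have : 0 < Complex.normSq (q 0) + Complex.normSq (q 1) :=
      lt_of_le_of_ne (by linarith) (Ne.symm hne)
    nlinarith
  have z0 : q 0 = 0 := Complex.normSq_eq_zero.1 (by linarith)
  have z1 : q 1 = 0 := Complex.normSq_eq_zero.1 (by linarith)
  have hp2' : p 2 ≠ 0 := by
    intro h
    simp [h] at hp2
  have z2 : q 2 = 0 := by
    simpa [z0, z1, hp2'] using horth
  apply hq
  ext i
  fin_cases i <;> assumption

lemma exists_adaptedFrame {p q : V3} (y : V3) (hp : (herm p p).re < 0) (hqp : herm q p = 0)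
    (hq : q ≠ 0) : ∃ e₁ e₂ : V3, ∃ ρ : ℝ, AdaptedFrame p e₁ e₂ ρ ∧ herm q e₁ = 1 ∧
      herm q e₂ = 0 ∧ (herm y e₂).im = 0 := by
  have hN := herm_pos_of_orthogonal_neg hp hqp hq
  set N := (herm q q).re with hNd
  set n := -(herm p p).re with hnd
  have hn : 0 < n := by linarith
  have hqq : herm q q = N := herm_self_eq_re q
  have hpp : herm p p = -(n : ℂ) := by rw [herm_self_eq_re p, hnd]; simp
  set x : V3 := ![conj (p 1 * q 2 - p 2 * q 1), conj (p 2 * q 0 - p 0 * q 2),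
    -conj (p 0 * q 1 - p 1 * q 0)] with hx
  have hxp : herm x p = 0 := by
    simp [herm, hx]; ring
  have hxq : herm x q = 0 := by
    simp [herm, hx]; ring
  have hxx : herm x x = (n * N : ℝ) := by
    have : herm x x = herm q p * herm p q - herm p p * herm q q := by
      simp [herm, hx]; ring
    rw [this, hqp, hpp, hqq]
    push_cast
    ring
  obtain ⟨μ, hμ1, hμ2⟩ : ∃ μ : ℂ, μ * conj μ = 1 ∧ (conj μ * herm y x).im = 0 := by
    obtain ⟨c, hc1, hc2⟩ := Complex.exists_norm_eq_mul_self (herm y x)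
    refine ⟨conj c, ?_, ?_⟩
    · rw [mul_comm, Complex.conj_conj, Complex.mul_conj, Complex.normSq_eq_norm_sq, hc1]
      simp
    · rw [Complex.conj_conj, ← hc2]
      simp
  have hsq : Real.sqrt n ^ 2 = n := Real.sq_sqrt hn.le
  have hsq0 : Real.sqrt n ≠ 0 := (Real.sqrt_pos.2 hn).ne'
  set k : ℝ := 1 / (N * Real.sqrt n) with hk
  have hk2 : k ^ 2 * (n * N) = 1 / N := by
    rw [hk]
    field_simp
    rw [hsq]
  have hNc : (N : ℂ) ≠ 0 := by exact_mod_cast hN.ne'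
  refine ⟨((1 / N : ℝ) : ℂ) • q, ((k : ℂ) * μ) • x, 1 / N, ⟨hp, by positivity, ?_, ?_, ?_, ?_, ?_⟩,
    ?_, ?_, ?_⟩
  · rw [herm_smul_left, herm_smul_right, hqq, Complex.conj_ofReal]
    push_cast
    field_simp
  · rw [herm_smul_left, herm_smul_right, hxx, ← hk2, map_mul, Complex.conj_ofReal]
    push_cast
    linear_combination ((k : ℂ) ^ 2 * n * N) * hμ1
  · rw [herm_smul_left, herm_smul_right, ← herm_conj_symm x q, hxq]
    simp
  · rw [herm_smul_left, hqp, mul_zero]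
  · rw [herm_smul_left, hxp, mul_zero]
  · rw [herm_smul_right, hqq, Complex.conj_ofReal]
    push_cast
    field_simp
  · rw [herm_smul_right, ← herm_conj_symm x q, hxq]
    simp
  · rw [herm_smul_right, map_mul, Complex.conj_ofReal, mul_assoc, Complex.im_ofReal_mul, hμ2, mul_zero]

namespace AdaptedFrame

variable {p e₁ e₂ : V3} {ρ : ℝ}

lemma p_e₁ (F : AdaptedFrame p e₁ e₂ ρ) : herm p e₁ = 0 := by
  rw [← herm_conj_symm, F.e₁_p, map_zero]

lemma p_e₂ (F : AdaptedFrame p e₁ e₂ ρ) : herm p e₂ = 0 := by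
  rw [← herm_conj_symm, F.e₂_p, map_zero]

lemma e₂_e₁ (F : AdaptedFrame p e₁ e₂ ρ) : herm e₂ e₁ = 0 := by
  rw [← herm_conj_symm, F.e₁_e₂, map_zero]

lemma p_p_ne (F : AdaptedFrame p e₁ e₂ ρ) : herm p p ≠ 0 := fun h => by
  simpa [h] using F.neg

lemma ρ_ne (F : AdaptedFrame p e₁ e₂ ρ) : (ρ : ℂ) ≠ 0 := by
  exact_mod_cast F.pos.ne'

lemma linearIndependent (F : AdaptedFrame p e₁ e₂ ρ) : LinearIndependent ℂ ![p, e₁, e₂] := by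
  rw [Fintype.linearIndependent_iff]
  intro g hg
  simp only [Fin.sum_univ_three, Matrix.cons_val_zero, Matrix.cons_val_one,
    Matrix.cons_val] at hg
  have key : ∀ z : V3, g 0 * herm p z + g 1 * herm e₁ z + g 2 * herm e₂ z = 0 := by
    intro z
    rw [← herm_smul_left, ← herm_smul_left, ← herm_smul_left, ← herm_add_left, ← herm_add_left, hg]
    simp [herm]
  have h0 := key p
  have h1 := key e₁
  have h2 := key e₂
  simp [F.e₁_p, F.e₂_p, F.p_e₁, F.p_e₂, F.e₁_e₂, F.e₂_e₁, F.e₁_e₁, F.e₂_e₂, F.p_p_ne,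
    F.pos.ne'] at h0 h1 h2
  intro i
  fin_cases i <;> assumption

/-- The basis `p, e₁, e₂` of `V`. -/
def basis (F : AdaptedFrame p e₁ e₂ ρ) : Module.Basis (Fin 3) ℂ V3 :=
  basisOfLinearIndependentOfCardEqFinrank F.linearIndependent (by simp)

lemma basis_coe (F : AdaptedFrame p e₁ e₂ ρ) : ⇑F.basis = ![p, e₁, e₂] :=
  coe_basisOfLinearIndependentOfCardEqFinrank _ _

lemma sum_repr (F : AdaptedFrame p e₁ e₂ ρ) (x : V3) :
    F.basis.repr x 0 • p + F.basis.repr x 1 • e₁ + F.basis.repr x 2 • e₂ = x := by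
  have := F.basis.sum_repr x
  simpa [Fin.sum_univ_three, F.basis_coe] using this

lemma herm_p (F : AdaptedFrame p e₁ e₂ ρ) (x : V3) :
    herm x p = F.basis.repr x 0 * herm p p := by
  conv_lhs => rw [← F.sum_repr x]
  simp [herm_add_left, herm_smul_left, F.e₁_p, F.e₂_p]

lemma herm_e₁ (F : AdaptedFrame p e₁ e₂ ρ) (x : V3) :
    herm x e₁ = F.basis.repr x 1 * ρ := by
  conv_lhs => rw [← F.sum_repr x]
  simp [herm_add_left, herm_smul_left, F.e₁_e₁, F.e₂_e₁, F.p_e₁]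

lemma herm_e₂ (F : AdaptedFrame p e₁ e₂ ρ) (x : V3) :
    herm x e₂ = F.basis.repr x 2 * ρ := by
  conv_lhs => rw [← F.sum_repr x]
  simp [herm_add_left, herm_smul_left, F.e₁_e₂, F.e₂_e₂, F.p_e₂]

lemma eq_zero_of_herm (F : AdaptedFrame p e₁ e₂ ρ) {x : V3} (h0 : herm x p = 0)
    (h1 : herm x e₁ = 0) (h2 : herm x e₂ = 0) : x = 0 := by
  rw [F.herm_p, mul_eq_zero, or_iff_left F.p_p_ne] at h0
  rw [F.herm_e₁, mul_eq_zero, or_iff_left F.ρ_ne] at h1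
  rw [F.herm_e₂, mul_eq_zero, or_iff_left F.ρ_ne] at h2
  rw [← F.sum_repr x, h0, h1, h2]
  simp

lemma herm_map_e₂_e₂ (F : AdaptedFrame p e₁ e₂ ρ) {h : Module.End ℂ V3}
    (htr : LinearMap.trace ℂ V3 h = 0) (hp : herm (h p) p = 0) :
    herm (h e₂) e₂ = -herm (h e₁) e₁ := by
  rw [LinearMap.trace_eq_matrix_trace ℂ F.basis, Matrix.trace, Fin.sum_univ_three] at htr
  simp only [Matrix.diag, LinearMap.toMatrix_apply, F.basis_coe, Matrix.cons_val_zero,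
    Matrix.cons_val_one, Matrix.cons_val] at htr
  rw [F.herm_p, mul_eq_zero, or_iff_left F.p_p_ne] at hp
  rw [F.herm_e₁, F.herm_e₂]
  linear_combination ρ * htr - ρ * hp

lemma herm_map_self (F : AdaptedFrame p e₁ e₂ ρ) {h : Module.End ℂ V3} (hs : SelfAdj h)
    (htr : LinearMap.trace ℂ V3 h = 0) (hp : herm (h p) p = 0) (z w₁ w₂ : ℂ) :
    herm (h (z • p + w₁ • e₁ + w₂ • e₂)) (z • p + w₁ • e₁ + w₂ • e₂) =
      (affineForm (herm (h e₁) e₁).re (herm (h e₁) e₂) (z * herm (h p) e₁) (z * herm (h p) e₂)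
        (w₁, w₂) : ℝ) := by
  have h11 : herm (h e₁) e₁ = (herm (h e₁) e₁).re :=
    Complex.ext rfl (by simp [hs.herm_self_im])
  have h22 := F.herm_map_e₂_e₂ htr hp
  have h1p : herm (h e₁) p = conj (herm (h p) e₁) := by rw [herm_conj_symm, hs]
  have h2p : herm (h e₂) p = conj (herm (h p) e₂) := by rw [herm_conj_symm, hs]
  have h21 : herm (h e₂) e₁ = conj (herm (h e₁) e₂) := by rw [herm_conj_symm, hs]
  simp only [map_add, map_smul, herm_add_left, herm_add_right, herm_smul_left, herm_smul_right,
    hp, h22, h1p, h2p, h21]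
  rw [h11]
  generalize (herm (h e₁) e₁).re = a
  generalize herm (h e₁) e₂ = b
  generalize herm (h p) e₁ = c
  generalize herm (h p) e₂ = d
  apply Complex.ext
  · simp [affineForm, tracelessForm_apply, reLinear_apply]
    ring
  · simp
    ring

lemma not_slice (F : AdaptedFrame p e₁ e₂ ρ) {h₁ h₂ : Module.End ℂ V3}
    (hs₁ : SelfAdj h₁) (hs₂ : SelfAdj h₂) (ht₁ : LinearMap.trace ℂ V3 h₁ = 0)
    (ht₂ : LinearMap.trace ℂ V3 h₂ = 0) (hp₁ : herm (h₁ p) p = 0) (hp₂ : herm (h₂ p) p = 0)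
    (hnoslice : ∀ U : Submodule ℂ V3, Module.finrank ℂ U = 2 → p ∈ U →
      ¬ projC U ⊆ Bset h₁ ∩ Bset h₂) :
    ¬ ((herm (h₁ e₁) e₁).re = 0 ∧ (herm (h₂ e₁) e₁).re = 0 ∧ herm (h₁ p) e₂ = 0 ∧
      herm (h₂ p) e₂ = 0) := by
  rintro ⟨ha₁, ha₂, hd₁, hd₂⟩
  have hli : LinearIndependent ℂ ![p, e₂] := by
    have := F.linearIndependent.comp ![0, 2] (by decide)
    convert this using 1
    ext i
    fin_cases i <;> rfl
  refine hnoslice (Submodule.span ℂ (Set.range ![p, e₂])) (by simp [finrank_span_eq_card hli])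
    (Submodule.subset_span ⟨0, rfl⟩) ?_
  rintro q ⟨v, hv, hvU, rfl⟩
  obtain ⟨c, rfl⟩ := (Submodule.mem_span_range_iff_exists_fun ℂ).1 hvU
  have e : ∑ i, c i • ![p, e₂] i = c 0 • p + (0 : ℂ) • e₁ + c 1 • e₂ := by
    simp [Fin.sum_univ_two]
  refine ⟨⟨_, hv, rfl, ?_⟩, ⟨_, hv, rfl, ?_⟩⟩
  · rw [e, F.herm_map_self hs₁ ht₁ hp₁, ha₁, hd₁]
    simp [affineForm, tracelessForm_apply, reLinear_apply]
  · rw [e, F.herm_map_self hs₂ ht₂ hp₂, ha₂, hd₂]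
    simp [affineForm, tracelessForm_apply, reLinear_apply]

/-- The `ℝ`-span of `p, i e₁, i e₂` is not contained in both bisectors. -/
lemma not_realPlane (F : AdaptedFrame p e₁ e₂ ρ) {h₁ h₂ : Module.End ℂ V3} (hp0 : p ≠ 0)
    (hs₁ : SelfAdj h₁) (hs₂ : SelfAdj h₂) (ht₁ : LinearMap.trace ℂ V3 h₁ = 0)
    (ht₂ : LinearMap.trace ℂ V3 h₂ = 0) (hp₁ : herm (h₁ p) p = 0) (hp₂ : herm (h₂ p) p = 0)
    (hnoplane : ∀ T : Submodule ℝ V3, IsRealPlane T → projMk p hp0 ∈ projR T →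
      ¬ projR T ⊆ Bset h₁ ∩ Bset h₂) :
    ¬ (((herm (h₁ e₁) e₁).re = 0 ∧ (herm (h₁ e₁) e₂).re = 0 ∧ (herm (h₁ p) e₁).im = 0 ∧
        (herm (h₁ p) e₂).im = 0) ∧
      ((herm (h₂ e₁) e₁).re = 0 ∧ (herm (h₂ e₁) e₂).re = 0 ∧ (herm (h₂ p) e₁).im = 0 ∧
        (herm (h₂ p) e₂).im = 0)) := by
  rintro ⟨⟨ha₁, hb₁, hc₁, hd₁⟩, ⟨ha₂, hb₂, hc₂, hd₂⟩⟩
  have hli : LinearIndependent ℂ ![p, Complex.I • e₁, Complex.I • e₂] := by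
    have := F.linearIndependent.units_smul
      ![1, Units.mk0 Complex.I Complex.I_ne_zero, Units.mk0 Complex.I Complex.I_ne_zero]
    convert this using 1
    ext i
    fin_cases i <;> simp
  set T := Submodule.span ℝ (Set.range ![p, Complex.I • e₁, Complex.I • e₂]) with hT
  have mem : ∀ v ∈ T, ∃ x y z : ℝ,
      v = (x : ℂ) • p + (y * Complex.I : ℂ) • e₁ + (z * Complex.I : ℂ) • e₂ := by
    intro v hv
    obtain ⟨c, rfl⟩ := (Submodule.mem_span_range_iff_exists_fun ℝ).1 hv
    refine ⟨c 0, c 1, c 2, ?_⟩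
    simp [Fin.sum_univ_three, mul_smul]
  refine hnoplane T ⟨?_, ?_, ?_⟩ ⟨p, hp0, Submodule.subset_span ⟨0, rfl⟩, rfl⟩ ?_
  · rw [hT, finrank_span_eq_card (hli.restrict_scalars' ℝ)]
    simp
  · rw [eq_top_iff, ← hli.span_eq_top_of_card_eq_finrank (by simp)]
    exact Submodule.span_mono Submodule.subset_span
  · intro t ht t' ht'
    obtain ⟨x, y, z, rfl⟩ := mem t ht
    obtain ⟨x', y', z', rfl⟩ := mem t' ht'
    simp only [herm_add_left, herm_add_right, herm_smul_left, herm_smul_right, F.e₁_p, F.e₂_p,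
      F.p_e₁, F.p_e₂, F.e₁_e₂, F.e₂_e₁, F.e₁_e₁, F.e₂_e₂]
    simp [herm_self_im]
  · rintro q ⟨v, hv, hvT, rfl⟩
    obtain ⟨x, y, z, e⟩ := mem v hvT
    refine ⟨⟨v, hv, rfl, ?_⟩, ⟨v, hv, rfl, ?_⟩⟩
    · rw [e, F.herm_map_self hs₁ ht₁ hp₁, ha₁]
      simp [affineForm, tracelessForm_apply, reLinear_apply, hb₁, hc₁, hd₁]
    · rw [e, F.herm_map_self hs₂ ht₂ hp₂, ha₂]
      simp [affineForm, tracelessForm_apply, reLinear_apply, hb₂, hc₂, hd₂]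

lemma eq_zero_of_entries (F : AdaptedFrame p e₁ e₂ ρ) {g : Module.End ℂ V3} (hs : SelfAdj g)
    (htr : LinearMap.trace ℂ V3 g = 0) (hp : herm (g p) p = 0) (h11 : herm (g e₁) e₁ = 0)
    (h12 : herm (g e₁) e₂ = 0) (hp1 : herm (g p) e₁ = 0) (hp2 : herm (g p) e₂ = 0) : g = 0 := by
  have h22 := F.herm_map_e₂_e₂ htr hp
  have h1p : herm (g e₁) p = 0 := by rw [hs, ← herm_conj_symm, hp1, map_zero]
  have h2p : herm (g e₂) p = 0 := by rw [hs, ← herm_conj_symm, hp2, map_zero]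
  have h21 : herm (g e₂) e₁ = 0 := by rw [hs, ← herm_conj_symm, h12, map_zero]
  rw [h11, neg_zero] at h22
  apply F.basis.ext
  intro i
  rw [F.basis_coe]
  fin_cases i
  · exact F.eq_zero_of_herm hp hp1 hp2
  · exact F.eq_zero_of_herm h1p h11 h12
  · exact F.eq_zero_of_herm h2p h21 h22

end AdaptedFrame


/-- Lemma 4.7: if `B_{h₁} ∩ B_{h₂} ∩ U ⊆ B_{h₃}` near a suitable negative
point `p`, then `h₃` is in the real span of `h₁, h₂`. -/
theorem stmt_5 (h₁ h₂ h₃ : Module.End ℂ V3)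
    (hb₁ : IsBisector h₁) (hb₂ : IsBisector h₂) (hb₃ : IsBisector h₃)
    (p : V3) (hp0 : p ≠ 0) (hneg : (herm p p).re < 0)
    (hp1 : herm (h₁ p) p = 0) (hp2 : herm (h₂ p) p = 0)
    (hn1 : h₁ p ≠ 0) (hn2 : h₂ p ≠ 0)
    (hnoslice : ∀ U : Submodule ℂ V3, Module.finrank ℂ U = 2 → p ∈ U →
      ¬ projC U ⊆ Bset h₁ ∩ Bset h₂)
    (hnoplane : ∀ T : Submodule ℝ V3, IsRealPlane T → projMk p hp0 ∈ projR T →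
      ¬ projR T ⊆ Bset h₁ ∩ Bset h₂)
    (U : Set V3) (hU : IsOpen U) (hpU : p ∈ U)
    (hsub : ∀ v ∈ U, herm (h₁ v) v = 0 → herm (h₂ v) v = 0 → herm (h₃ v) v = 0) :
    ∃ a b : ℝ, h₃ = a • h₁ + b • h₂ := by
  obtain ⟨hs₁, ht₁, -, -⟩ := hb₁
  obtain ⟨hs₂, ht₂, -, -⟩ := hb₂
  obtain ⟨hs₃, ht₃, -, -⟩ := hb₃
  have hp3 : herm (h₃ p) p = 0 := hsub p hpU hp1 hp2
  obtain ⟨e₁, e₂, ρ, F, hc₁, hd₁, hd₂⟩ := exists_adaptedFrame (h₂ p) hneg hp1 hn1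
  have hd₂' : ((herm (h₂ p) e₂).re : ℂ) = herm (h₂ p) e₂ := Complex.ext rfl (by simp [hd₂])
  have hloc : ∀ᶠ w in 𝓝 (0 : ℂ × ℂ), (1 : ℂ) • p + w.1 • e₁ + w.2 • e₂ ∈ U := by
    have hcont : Continuous fun w : ℂ × ℂ => (1 : ℂ) • p + w.1 • e₁ + w.2 • e₂ := by fun_prop
    refine hcont.continuousAt.eventually_mem (hU.mem_nhds ?_)
    simpa using hpU
  obtain ⟨α, β, ha, hb, hc, hd⟩ := affineForm_coeff_comb (herm (h₁ e₁) e₁).re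
    (herm (h₂ e₁) e₁).re (herm (h₃ e₁) e₁).re (herm (h₂ p) e₂).re (herm (h₁ e₁) e₂)
    (herm (h₂ e₁) e₂) (herm (h₃ e₁) e₂) (herm (h₂ p) e₁) (herm (h₃ p) e₁) (herm (h₃ p) e₂)
    (by
      filter_upwards [hloc] with w hw h1 h2
      have := hsub _ hw
      rw [F.herm_map_self hs₁ ht₁ hp1, F.herm_map_self hs₂ ht₂ hp2,
        F.herm_map_self hs₃ ht₃ hp3] at this
      simp only [one_mul, hc₁, hd₁, Complex.ofReal_eq_zero] at this
      rw [hd₂'] at h2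
      exact this h1 h2)
    (by
      rintro ⟨h1, h2, h3⟩
      exact F.not_slice hs₁ hs₂ ht₁ ht₂ hp1 hp2 hnoslice
        ⟨h1, h2, hd₁, by rw [← hd₂', h3, Complex.ofReal_zero]⟩)
    (by
      rintro ⟨h1, h2, h3, h4, h5⟩
      exact F.not_realPlane hp0 hs₁ hs₂ ht₁ ht₂ hp1 hp2 hnoplane
        ⟨⟨h1, h3, by simp [hc₁], by simp [hd₁]⟩, ⟨h2, h4, h5, hd₂⟩⟩)
  rw [hd₂'] at hd
  refine ⟨α, β, ?_⟩
  have hherm : ∀ x y : V3, herm ((h₃ - α • h₁ - β • h₂) x) y =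
      herm (h₃ x) y - α * herm (h₁ x) y - β * herm (h₂ x) y := by
    intro x y
    simp [herm]
    ring
  have hherm' : ∀ x y : V3, herm x ((h₃ - α • h₁ - β • h₂) y) =
      herm x (h₃ y) - α * herm x (h₁ y) - β * herm x (h₂ y) := by
    intro x y
    simp [herm]
    ring
  have hre : ∀ {h : Module.End ℂ V3}, SelfAdj h → herm (h e₁) e₁ = (herm (h e₁) e₁).re :=
    fun hs => Complex.ext rfl (by simp [hs.herm_self_im])
  have hg : h₃ - α • h₁ - β • h₂ = 0 := by
    apply F.eq_zero_of_entries
    · intro x y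
      rw [hherm, hherm', hs₁, hs₂, hs₃]
    · simp [LinearMap.map_smul_of_tower, ht₁, ht₂, ht₃]
    · rw [hherm, hp1, hp2, hp3]
      ring
    · rw [hherm, hre hs₁, hre hs₂, hre hs₃, ha]
      push_cast
      ring
    · rw [hherm, hb]
      ring
    · rw [hherm, hc, hc₁]
      ring
    · rw [hherm, hd, hd₁]
      ring
  rw [sub_sub, sub_eq_zero] at hg
  exact hg

end
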